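/- arXiv:1809.03812 — 2 statements merged into one kernel-verified Lean document; each statement's English description precedes it below -/
import Mathlib

section
/- Let p ∈ [1,∞), c, ω > 0, w_n = c·ωⁿ, I ⊆ ℝ an interval, τ₀ ∈ I, and let V, Ṽ : I → ℝ be continuous. Let M, M̃ : I → ℓ^p(w;ℝ³) be the continuously differentiable solutions of the moment ODE (∂_τ M(τ))_n = A(τ)M(τ)_n + B·M(τ)_{n+1} for the potentials V and Ṽ respectively, with initial data M(τ₀) = M⁰ and M̃(τ₀) = M̃⁰ in ℓ^p(w;ℝ³). Then for all τ ∈ I with τ ≥ τ₀: ‖M(τ) − M̃(τ)‖_{p,w} ≤ exp(C_ω(τ,τ₀))·‖M⁰ − M̃⁰‖_{p,w} + 2·exp(C_ω(τ,τ₀) + C̃_ω(τ,τ₀))·‖M̃⁰‖_{p,w}·∫_{τ₀}^{τ} |V(η) − Ṽ(η)| dη, where C_ω(τ,τ₀) = 2ω|τ−τ₀| + 2|∫_{τ₀}^{τ} √(1+V(η)²) dη| and C̃_ω is defined analogously with Ṽ. -/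
open scoped ENNReal
open MeasureTheory intervalIntegral

/-- The matrix `A(τ)` of the moment dynamics, with rows `(0,2,0)`, `(−V,0,1)`, `(0,−2V,0)`. -/
noncomputable def matA (v : ℝ) : Matrix (Fin 3) (Fin 3) ℝ :=
  !![0, 2, 0; -v, 0, 1; 0, -2 * v, 0]

/-- The matrix `B` of the moment dynamics, with rows `(0,0,0)`, `(1,0,0)`, `(0,2,0)`. -/
noncomputable def matB : Matrix (Fin 3) (Fin 3) ℝ :=
  !![0, 0, 0; 1, 0, 0; 0, 2, 0]

/-- `C_ω(τ,τ₀) = 2ω|τ−τ₀| + 2|∫_{τ₀}^{τ} √(1+V(η)²) dη|`. -/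
noncomputable def Cω (ω : ℝ) (V : ℝ → ℝ) (τ τ₀ : ℝ) : ℝ :=
  2 * ω * |τ - τ₀| + 2 * |∫ η in τ₀..τ, Real.sqrt (1 + V η ^ 2)|

/-- Grönwall's inequality with continuous nonnegative coefficients. -/
theorem norm_le_exp_integral_mul_of_norm_deriv_le {E : Type*} [NormedAddCommGroup E]
    [NormedSpace ℝ E] {f f' : ℝ → E} {β g : ℝ → ℝ} {a b : ℝ} (hab : a ≤ b)
    (hβ : Continuous β) (hg : Continuous g) (hβ0 : ∀ x, 0 ≤ β x) (hg0 : ∀ x, 0 ≤ g x)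
    (hf : ContinuousOn f (Set.Icc a b))
    (hf' : ∀ x ∈ Set.Ico a b, HasDerivWithinAt f (f' x) (Set.Ici x) x)
    (bound : ∀ x ∈ Set.Ico a b, ‖f' x‖ ≤ β x * ‖f x‖ + g x) :
    ‖f b‖ ≤ Real.exp (∫ η in a..b, β η) * (‖f a‖ + ∫ η in a..b, g η) := by
  have key : ∀ ε : ℝ, 0 < ε → ‖f b‖ ≤
      Real.exp ((∫ η in a..b, β η) + ε * (b - a)) * (‖f a‖ + ε + ∫ η in a..b, g η) := by
    intro ε hε
    have hβd : ∀ x, HasDerivAt (fun u => ∫ η in a..u, β η) (β x) x := fun x =>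
      integral_hasDerivAt_right (hβ.intervalIntegrable _ _)
        (hβ.stronglyMeasurableAtFilter _ _) hβ.continuousAt
    have hgd : ∀ x, HasDerivAt (fun u => ∫ η in a..u, g η) (g x) x := fun x =>
      integral_hasDerivAt_right (hg.intervalIntegrable _ _)
        (hg.stronglyMeasurableAtFilter _ _) hg.continuousAt
    have hB : ∀ x, HasDerivAt
        (fun u => Real.exp ((∫ η in a..u, β η) + ε * (u - a)) *
          (‖f a‖ + ε + ∫ η in a..u, g η))
        (Real.exp ((∫ η in a..x, β η) + ε * (x - a)) * (β x + ε) *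
          (‖f a‖ + ε + ∫ η in a..x, g η) +
          Real.exp ((∫ η in a..x, β η) + ε * (x - a)) * g x) x := by
      intro x
      have h1 : HasDerivAt (fun u => (∫ η in a..u, β η) + ε * (u - a)) (β x + ε) x := by
        have h2 : HasDerivAt (fun u => ε * (u - a)) ε x := by
          simpa using ((hasDerivAt_id x).sub_const a).const_mul ε
        exact (hβd x).add h2
      exact h1.exp.mul ((hgd x).const_add (‖f a‖ + ε))
    refine image_norm_le_of_norm_deriv_right_lt_deriv_boundary hf hf' (by simp [hε.le]) hB
      (fun x hx hfx => (bound x hx).trans_lt ?_) (Set.right_mem_Icc.2 hab)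
    have hG : 0 ≤ ∫ η in a..x, g η := integral_nonneg hx.1 fun u _ => hg0 u
    have hb : 0 ≤ ∫ η in a..x, β η := integral_nonneg hx.1 fun u _ => hβ0 u
    have hexp : 1 ≤ Real.exp ((∫ η in a..x, β η) + ε * (x - a)) :=
      Real.one_le_exp (add_nonneg hb (mul_nonneg hε.le (sub_nonneg.2 hx.1)))
    rw [hfx]
    have h1 : 0 < Real.exp ((∫ η in a..x, β η) + ε * (x - a)) *
        (‖f a‖ + ε + ∫ η in a..x, g η) * ε := by positivity
    have h2 := mul_le_mul_of_nonneg_right hexp (hg0 x)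
    linarith
  have hlim : Filter.Tendsto (fun ε : ℝ =>
      Real.exp ((∫ η in a..b, β η) + ε * (b - a)) * (‖f a‖ + ε + ∫ η in a..b, g η))
      (nhdsWithin 0 (Set.Ioi 0))
      (nhds (Real.exp (∫ η in a..b, β η) * (‖f a‖ + ∫ η in a..b, g η))) := by
    have hc : Continuous fun ε : ℝ =>
        Real.exp ((∫ η in a..b, β η) + ε * (b - a)) *
          (‖f a‖ + ε + ∫ η in a..b, g η) := by fun_prop
    simpa using (hc.tendsto 0).mono_left nhdsWithin_le_nhds
  exact ge_of_tendsto hlim (Filter.eventually_of_mem self_mem_nhdsWithin key)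

/-- The left shift is a contraction of `lp`. -/
theorem lp.exists_shift_norm_le {E : Type*} [NormedAddCommGroup E] {p : ℝ≥0∞}
    (hp : 0 < p.toReal) (x : lp (fun _ : ℕ => E) p) :
    ∃ s : lp (fun _ : ℕ => E) p, (∀ n, s n = x (n + 1)) ∧ ‖s‖ ≤ ‖x‖ := by
  have hx := (lp.memℓp x).summable hp
  refine ⟨⟨fun n => x (n + 1), memℓp_gen ((summable_nat_add_iff 1).2 hx)⟩, fun n => rfl, ?_⟩
  refine lp.norm_le_of_tsum_le hp (norm_nonneg' x) ?_
  rw [lp.norm_rpow_eq_tsum hp, hx.tsum_eq_zero_add]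
  exact le_add_of_nonneg_left (by positivity)

theorem lp.norm_le_of_forall_norm_le_add_shift {E : Type*} [NormedAddCommGroup E] {p : ℝ≥0∞}
    [Fact (1 ≤ p)] (hp : p ≠ ∞) {x y z : lp (fun _ : ℕ => E) p} {a b k : ℝ}
    (ha : 0 ≤ a) (hb : 0 ≤ b) (hk : 0 ≤ k)
    (h : ∀ n, ‖z n‖ ≤ a * ‖x n‖ + b * ‖x (n + 1)‖ + k * ‖y n‖) :
    ‖z‖ ≤ (a + b) * ‖x‖ + k * ‖y‖ := by
  have hp0 : p ≠ 0 := (zero_lt_one.trans_le (Fact.out : 1 ≤ p)).ne'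
  obtain ⟨s, hs, hsx⟩ := lp.exists_shift_norm_le (ENNReal.toReal_pos hp0 hp) x
  have h1 : ‖z‖ ≤ ‖a • lp.toNorm x + b • lp.toNorm s + k • lp.toNorm y‖ := by
    refine lp.norm_mono hp0 fun n => (h n).trans ((le_abs_self _).trans_eq ?_)
    rw [← hs, Real.norm_eq_abs]
    rfl
  calc ‖z‖ ≤ _ := h1
    _ ≤ ‖a • lp.toNorm x‖ + ‖b • lp.toNorm s‖ + ‖k • lp.toNorm y‖ := norm_add₃_le
    _ = a * ‖x‖ + b * ‖s‖ + k * ‖y‖ := by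
      simp only [norm_smul, lp.norm_toNorm, Real.norm_of_nonneg ha, Real.norm_of_nonneg hb,
        Real.norm_of_nonneg hk]
    _ ≤ (a + b) * ‖x‖ + k * ‖y‖ := by
      have := mul_le_mul_of_nonneg_left hsx hb
      linarith

theorem norm_matA_mulVec_le (v : ℝ) (x : Fin 3 → ℝ) :
    ‖(matA v).mulVec x‖ ≤ 2 * Real.sqrt (1 + v ^ 2) * ‖x‖ := by
  have h0 : |x 0| ≤ ‖x‖ := norm_le_pi_norm x 0
  have h1 : |x 1| ≤ ‖x‖ := norm_le_pi_norm x 1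
  have h2 : |x 2| ≤ ‖x‖ := norm_le_pi_norm x 2
  have hx := norm_nonneg x
  have hs1 : 1 ≤ Real.sqrt (1 + v ^ 2) := Real.one_le_sqrt.2 (by nlinarith)
  have hsv : |v| ≤ Real.sqrt (1 + v ^ 2) := Real.abs_le_sqrt (by linarith)
  have hv := abs_nonneg v
  refine (pi_norm_le_iff_of_nonneg (by positivity)).2 fun i => ?_
  fin_cases i
  · have : |2 * x 1| ≤ 2 * Real.sqrt (1 + v ^ 2) * ‖x‖ := by
      rw [abs_mul, abs_two]
      nlinarith
    simpa [matA, Matrix.mulVec, dotProduct, Fin.sum_univ_three] using this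
  · have : |-(v * x 0) + x 2| ≤ 2 * Real.sqrt (1 + v ^ 2) * ‖x‖ := by
      refine (abs_add_le _ _).trans ?_
      rw [abs_neg, abs_mul]
      have := mul_le_mul hsv h0 (abs_nonneg _) (Real.sqrt_nonneg _)
      nlinarith
    simpa [matA, Matrix.mulVec, dotProduct, Fin.sum_univ_three] using this
  · have : |2 * v * x 1| ≤ 2 * Real.sqrt (1 + v ^ 2) * ‖x‖ := by
      rw [abs_mul, abs_mul, abs_two]
      have := mul_le_mul hsv h1 (abs_nonneg _) (Real.sqrt_nonneg _)
      nlinarith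
    simpa [matA, Matrix.mulVec, dotProduct, Fin.sum_univ_three] using this

theorem norm_matB_mulVec_le (x : Fin 3 → ℝ) : ‖matB.mulVec x‖ ≤ 2 * ‖x‖ := by
  have h0 : |x 0| ≤ ‖x‖ := norm_le_pi_norm x 0
  have h1 : |x 1| ≤ ‖x‖ := norm_le_pi_norm x 1
  have hx := norm_nonneg x
  refine (pi_norm_le_iff_of_nonneg (by positivity)).2 fun i => ?_
  fin_cases i
  · simp [matB, Matrix.mulVec, dotProduct, Fin.sum_univ_three]
  · simp [matB, Matrix.mulVec, dotProduct, Fin.sum_univ_three]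
    linarith
  · simp [matB, Matrix.mulVec, dotProduct, Fin.sum_univ_three]
    linarith

theorem norm_matA_sub_mulVec_le (v w : ℝ) (x : Fin 3 → ℝ) :
    ‖(matA v).mulVec x - (matA w).mulVec x‖ ≤ 2 * |v - w| * ‖x‖ := by
  have h0 : |x 0| ≤ ‖x‖ := norm_le_pi_norm x 0
  have h1 : |x 1| ≤ ‖x‖ := norm_le_pi_norm x 1
  have hx := norm_nonneg x
  have hv := abs_nonneg (v - w)
  refine (pi_norm_le_iff_of_nonneg (by positivity)).2 fun i => ?_
  fin_cases i
  · simp [matA, dotProduct, Fin.sum_univ_three]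
    positivity
  · have : ((matA v).mulVec x - (matA w).mulVec x) 1 = -((v - w) * x 0) := by
      simp [matA, dotProduct, Fin.sum_univ_three]
      ring
    change |((matA v).mulVec x - (matA w).mulVec x) 1| ≤ _
    rw [this, abs_neg, abs_mul]
    nlinarith
  · have : ((matA v).mulVec x - (matA w).mulVec x) 2 = -(2 * (v - w) * x 1) := by
      simp [matA, dotProduct, Fin.sum_univ_three]
      ring
    change |((matA v).mulVec x - (matA w).mulVec x) 2| ≤ _
    rw [this, abs_neg, abs_mul, abs_mul, abs_two]
    nlinarith

/-- The moment equation for the weighted representatives, with the weights cancelled. -/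
theorem moment_eq_of_weighted {c ω : ℝ} (hc : 0 < c) (hω : 0 < ω) {v : ℝ} {n : ℕ}
    {x' x y : Fin 3 → ℝ}
    (h : (c * ω ^ n) • x' = (matA v).mulVec ((c * ω ^ n) • x)
      + matB.mulVec ((c * ω ^ (n + 1)) • y)) :
    x' = (matA v).mulVec x + ω • matB.mulVec y := by
  have hw : c * ω ^ n ≠ 0 := by positivity
  refine smul_right_injective _ hw ?_
  simp only [h, Matrix.mulVec_smul, smul_add, smul_smul, pow_succ, mul_assoc]

theorem norm_sub_le_of_moment_eq {p : ℝ≥0∞} [Fact (1 ≤ p)] (hp : p ≠ ∞) {ω v w : ℝ}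
    (hω : 0 < ω) {x' x y' y : lp (fun _ : ℕ => Fin 3 → ℝ) p}
    (hx : ∀ n, x' n = (matA v).mulVec (x n) + ω • matB.mulVec (x (n + 1)))
    (hy : ∀ n, y' n = (matA w).mulVec (y n) + ω • matB.mulVec (y (n + 1))) :
    ‖x' - y'‖ ≤ (2 * Real.sqrt (1 + v ^ 2) + 2 * ω) * ‖x - y‖ + 2 * |v - w| * ‖y‖ := by
  refine lp.norm_le_of_forall_norm_le_add_shift hp (by positivity) (by positivity)
    (by positivity) fun n => ?_
  have h : (x' - y') n = (matA v).mulVec ((x - y) n) + ω • matB.mulVec ((x - y) (n + 1))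
      + ((matA v).mulVec (y n) - (matA w).mulVec (y n)) := by
    simp only [lp.coeFn_sub, Pi.sub_apply, hx, hy, Matrix.mulVec_sub, smul_sub]
    abel
  rw [h]
  refine norm_add₃_le.trans ?_
  have hB := mul_le_mul_of_nonneg_left (norm_matB_mulVec_le ((x - y) (n + 1))) hω.le
  rw [norm_smul, Real.norm_of_nonneg hω.le]
  linarith [norm_matA_mulVec_le v ((x - y) n), norm_matA_sub_mulVec_le v w (y n)]

/-- Grönwall estimate for two moment solutions on a compact interval, where the forcing is
bounded through any uniform bound `K` on the second solution. -/
theorem norm_sub_le_of_moment_solutions {p : ℝ≥0∞} [Fact (1 ≤ p)] (hp : p ≠ ∞) {ω : ℝ}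
    (hω : 0 < ω) {a b K : ℝ} (hab : a ≤ b) {V W : ℝ → ℝ}
    (hV : ContinuousOn V (Set.Icc a b)) (hW : ContinuousOn W (Set.Icc a b))
    {F F' G G' : ℝ → lp (fun _ : ℕ => Fin 3 → ℝ) p}
    (hF : ∀ t ∈ Set.Icc a b, HasDerivWithinAt F (F' t) (Set.Icc a b) t)
    (hG : ∀ t ∈ Set.Icc a b, HasDerivWithinAt G (G' t) (Set.Icc a b) t)
    (hFode : ∀ t ∈ Set.Icc a b, ∀ n,
      F' t n = (matA (V t)).mulVec (F t n) + ω • matB.mulVec (F t (n + 1)))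
    (hGode : ∀ t ∈ Set.Icc a b, ∀ n,
      G' t n = (matA (W t)).mulVec (G t n) + ω • matB.mulVec (G t (n + 1)))
    (hK : ∀ t ∈ Set.Icc a b, ‖G t‖ ≤ K) :
    ‖F b - G b‖ ≤ Real.exp (Cω ω V b a) *
      (‖F a - G a‖ + 2 * K * ∫ η in a..b, |V η - W η|) := by
  have hK0 : 0 ≤ K := (norm_nonneg _).trans (hK a (Set.left_mem_Icc.2 hab))
  have hVe : Continuous (Set.IccExtend hab ((Set.Icc a b).domRestrict V)) := hV.domRestrict.Icc_extend'
  have hWe : Continuous (Set.IccExtend hab ((Set.Icc a b).domRestrict W)) := hW.domRestrict.Icc_extend'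
  set v := Set.IccExtend hab ((Set.Icc a b).domRestrict V)
  set w := Set.IccExtend hab ((Set.Icc a b).domRestrict W)
  have hv : ∀ t ∈ Set.Icc a b, v t = V t := fun t ht => Set.IccExtend_of_mem hab _ ht
  have hw : ∀ t ∈ Set.Icc a b, w t = W t := fun t ht => Set.IccExtend_of_mem hab _ ht
  have hD : ∀ t ∈ Set.Icc a b,
      HasDerivWithinAt (F - G) (F' t - G' t) (Set.Icc a b) t :=
    fun t ht => (hF t ht).sub (hG t ht)
  have hmain := norm_le_exp_integral_mul_of_norm_deriv_le (f := F - G)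
    (f' := fun t => F' t - G' t) (β := fun t => 2 * Real.sqrt (1 + v t ^ 2) + 2 * ω)
    (g := fun t => 2 * K * |v t - w t|) hab (by fun_prop) (by fun_prop)
    (fun t => by positivity) (fun t => by positivity)
    (fun t ht => (hD t ht).continuousWithinAt)
    (fun t ht => (hD t (Set.Ico_subset_Icc_self ht)).mono_of_mem_nhdsWithin
      (Icc_mem_nhdsGE_of_mem ht)) ?_
  · have hg : (∫ η in a..b, 2 * K * |v η - w η|) = 2 * K * ∫ η in a..b, |V η - W η| := by
      rw [intervalIntegral.integral_const_mul]
      congr 1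
      refine integral_congr fun t ht => ?_
      rw [Set.uIcc_of_le hab] at ht
      simp only [hv t ht, hw t ht]
    have hβ : (∫ η in a..b, (2 * Real.sqrt (1 + v η ^ 2) + 2 * ω)) = Cω ω V b a := by
      have hsq : (∫ η in a..b, Real.sqrt (1 + v η ^ 2)) = ∫ η in a..b, Real.sqrt (1 + V η ^ 2) := by
        refine integral_congr fun t ht => ?_
        rw [Set.uIcc_of_le hab] at ht
        simp only [hv t ht]
      rw [intervalIntegral.integral_add (Continuous.intervalIntegrable (by fun_prop) _ _)
        (by simp), intervalIntegral.integral_const_mul, hsq, Cω, abs_of_nonneg (sub_nonneg.2 hab),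
        abs_of_nonneg (integral_nonneg hab fun _ _ => Real.sqrt_nonneg _)]
      simp only [intervalIntegral.integral_const, smul_eq_mul]
      ring
    rwa [hg, hβ] at hmain
  · intro t ht
    have ht' := Set.Ico_subset_Icc_self ht
    rw [hv t ht', hw t ht']
    refine (norm_sub_le_of_moment_eq hp hω (hFode t ht') (hGode t ht')).trans ?_
    have := mul_le_mul_of_nonneg_left (hK t ht') (by positivity : 0 ≤ 2 * |V t - W t|)
    simp only [Pi.sub_apply]
    linarith

theorem Cω_mono {ω : ℝ} (hω : 0 < ω) {V : ℝ → ℝ} {a s b : ℝ} (has : a ≤ s) (hsb : s ≤ b)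
    (hV : ContinuousOn V (Set.Icc a b)) : Cω ω V s a ≤ Cω ω V b a := by
  have hint : IntervalIntegrable (fun η => Real.sqrt (1 + V η ^ 2)) volume a b := by
    refine ContinuousOn.intervalIntegrable ?_
    rw [Set.uIcc_of_le (has.trans hsb)]
    fun_prop
  have hmono : (∫ η in a..s, Real.sqrt (1 + V η ^ 2)) ≤ ∫ η in a..b, Real.sqrt (1 + V η ^ 2) :=
    integral_mono_interval le_rfl has hsb (ae_of_all _ fun _ => Real.sqrt_nonneg _) hint
  rw [Cω, Cω, abs_of_nonneg (sub_nonneg.2 has), abs_of_nonneg (sub_nonneg.2 (has.trans hsb)),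
    abs_of_nonneg (integral_nonneg has fun _ _ => Real.sqrt_nonneg _),
    abs_of_nonneg (integral_nonneg (has.trans hsb) fun _ _ => Real.sqrt_nonneg _)]
  gcongr

/-- Theorem 4.11 of the paper. Perturbation estimate for the moment
dynamics with geometrically growing weights `w n = c·ωⁿ`: if `M, Mt` are the continuously
differentiable solutions of the moment ODE for continuous potentials `V, Vt` with initial
data `M⁰, Mt⁰ ∈ ℓ^p(w;ℝ³)`, then for `τ ≥ τ₀` in `I`,
`‖M(τ) − Mt(τ)‖ ≤ e^{C_ω}‖M⁰−Mt⁰‖ + 2 e^{C_ω+C̃_ω}‖Mt⁰‖ ∫_{τ₀}^{τ}|V−Vt|`.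
Elements of `ℓ^p(w;ℝ³)` are represented by their weighted representatives in `lp`
(`F` represents the moment sequence `n ↦ (c·ωⁿ) • F n`, the `lp`-norm of `F` being the
`‖·‖_{p,w}`-norm of the represented sequence). -/
theorem moment_dynamics_geometric_weights_perturbation
    (p : ℝ≥0∞) [Fact (1 ≤ p)] (hp : p ≠ ∞) (c ω : ℝ) (hc : 0 < c) (hω : 0 < ω)
    (I : Set ℝ) (hI : I.OrdConnected) (V Vt : ℝ → ℝ)
    (hV : ContinuousOn V I) (hVt : ContinuousOn Vt I)
    (τ₀ : ℝ) (hτ₀ : τ₀ ∈ I)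
    (M0 Mt0 : lp (fun _ : ℕ => Fin 3 → ℝ) p)
    (F F' Ft Ft' : ℝ → lp (fun _ : ℕ => Fin 3 → ℝ) p)
    (hF0 : F τ₀ = M0) (hFt0 : Ft τ₀ = Mt0)
    (hF'c : ContinuousOn F' I) (hFt'c : ContinuousOn Ft' I)
    (hFd : ∀ τ ∈ I, HasDerivWithinAt F (F' τ) I τ)
    (hFtd : ∀ τ ∈ I, HasDerivWithinAt Ft (Ft' τ) I τ)
    (hFode : ∀ τ ∈ I, ∀ n : ℕ,
      (c * ω ^ n) • (F' τ) n
        = (matA (V τ)).mulVec ((c * ω ^ n) • (F τ) n)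
          + matB.mulVec ((c * ω ^ (n + 1)) • (F τ) (n + 1)))
    (hFtode : ∀ τ ∈ I, ∀ n : ℕ,
      (c * ω ^ n) • (Ft' τ) n
        = (matA (Vt τ)).mulVec ((c * ω ^ n) • (Ft τ) n)
          + matB.mulVec ((c * ω ^ (n + 1)) • (Ft τ) (n + 1))) :
    ∀ τ ∈ I, τ₀ ≤ τ →
      ‖F τ - Ft τ‖ ≤ Real.exp (Cω ω V τ τ₀) * ‖M0 - Mt0‖
        + 2 * Real.exp (Cω ω V τ τ₀ + Cω ω Vt τ τ₀) * ‖Mt0‖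
          * ∫ η in τ₀..τ, |V η - Vt η| := by
  intro τ hτ hle
  have hsub : Set.Icc τ₀ τ ⊆ I := hI.out hτ₀ hτ
  have hFode' := fun t (ht : t ∈ Set.Icc τ₀ τ) n =>
    moment_eq_of_weighted hc hω (hFode t (hsub ht) n)
  have hFtode' := fun t (ht : t ∈ Set.Icc τ₀ τ) n =>
    moment_eq_of_weighted hc hω (hFtode t (hsub ht) n)
  have hK : ∀ s ∈ Set.Icc τ₀ τ, ‖Ft s‖ ≤ Real.exp (Cω ω Vt τ τ₀) * ‖Mt0‖ := by
    intro s hs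
    have hss : Set.Icc τ₀ s ⊆ Set.Icc τ₀ τ := Set.Icc_subset_Icc_right hs.2
    have h := norm_sub_le_of_moment_solutions hp hω (K := 0) (F := Ft) (F' := Ft')
      (G := fun _ => 0) (G' := fun _ => 0) hs.1 (hVt.mono (hss.trans hsub))
      (hVt.mono (hss.trans hsub))
      (fun t ht => (hFtd t (hsub (hss ht))).mono (hss.trans hsub))
      (fun t _ => hasDerivWithinAt_const _ _ _) (fun t ht => hFtode' t (hss ht))
      (fun t _ n => by simp) (fun t _ => by simp)
    simp only [sub_zero, mul_zero, zero_mul, add_zero, hFt0] at h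
    refine h.trans ?_
    have := Cω_mono hω hs.1 hs.2 (hVt.mono hsub)
    gcongr
  refine (norm_sub_le_of_moment_solutions hp hω hle (hV.mono hsub) (hVt.mono hsub)
    (fun t ht => (hFd t (hsub ht)).mono hsub) (fun t ht => (hFtd t (hsub ht)).mono hsub)
    hFode' hFtode' hK).trans_eq ?_
  rw [hF0, hFt0, Real.exp_add]
  ring
end

section
/- For p ∈ (0,1) real and m ≥ 1 an integer, let F(m) = ⨆_{n ∈ ℕ} C(n+m, m)·p^m·(1−p)^n (the supremum is finite since every term is at most 1). Then √(2πm)·√(1−p)·F(m) → 1 as m → ∞. -/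
open Filter

open Topology Stirling

/-- A sequence that increases up to the index `N` and decreases afterwards is maximal at `N`. -/
lemma le_of_le_succ_of_succ_le {a : ℕ → ℝ} {N : ℕ} (hinc : ∀ n < N, a n ≤ a (n + 1))
    (hdec : ∀ n, N ≤ n → a (n + 1) ≤ a n) (n : ℕ) : a n ≤ a N := by
  rcases le_total N n with h | h
  · induction n, h using Nat.le_induction with
    | base => exact le_rfl
    | succ n h ih => exact (hdec n h).trans ih
  · induction h using Nat.decreasingInduction with
    | self => exact le_rfl
    | of_succ k hk ih => exact (hinc k hk).trans ih

lemma choose_mul_pow_succ (p : ℝ) (m n : ℕ) :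
    ((n + 1 + m).choose m : ℝ) * p ^ m * (1 - p) ^ (n + 1) * (n + 1) =
      ((n + m).choose m : ℝ) * p ^ m * (1 - p) ^ n * ((1 - p) * (n + m + 1)) := by
  have h := Nat.choose_mul_succ_eq (n + m) m
  rw [show n + m + 1 - m = n + 1 by omega, show n + m + 1 = n + 1 + m by omega] at h
  have hcast : ((n + m).choose m : ℝ) * (n + 1 + m) = ((n + 1 + m).choose m : ℝ) * (n + 1) := by
    exact_mod_cast h
  rw [pow_succ]
  linear_combination (-(p ^ m * (1 - p) ^ n * (1 - p))) * hcast

/-- The supremum of `C(n+m,m) p^m (1-p)^n` over `n` is attained at `⌊(1-p)/p * m⌋`. -/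
lemma iSup_choose_mul_pow {p : ℝ} (hp0 : 0 < p) (hp1 : p < 1) (m : ℕ) :
    ⨆ n : ℕ, ((n + m).choose m : ℝ) * p ^ m * (1 - p) ^ n =
      ((⌊(1 - p) / p * m⌋₊ + m).choose m : ℝ) * p ^ m * (1 - p) ^ ⌊(1 - p) / p * (m : ℝ)⌋₊ := by
  have hq : 0 < 1 - p := sub_pos.2 hp1
  have hmax := le_of_le_succ_of_succ_le (N := ⌊(1 - p) / p * (m : ℝ)⌋₊)
    (a := fun n : ℕ => ((n + m).choose m : ℝ) * p ^ m * (1 - p) ^ n) ?_ ?_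
  · exact le_antisymm (ciSup_le hmax) (le_ciSup (f := fun n : ℕ =>
      ((n + m).choose m : ℝ) * p ^ m * (1 - p) ^ n) ⟨_, Set.forall_mem_range.2 hmax⟩ _)
  · intro n hn
    have h1 : ((n + 1 : ℕ) : ℝ) ≤ (1 - p) / p * m := (Nat.le_floor_iff (by positivity)).1 hn
    rw [div_mul_eq_mul_div, le_div_iff₀ hp0] at h1
    push_cast at h1
    refine le_of_mul_le_mul_right ?_ (by positivity : (0 : ℝ) < n + 1)
    rw [choose_mul_pow_succ]
    exact mul_le_mul_of_nonneg_left (by linarith) (by positivity)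
  · intro n hn
    have h1 : (1 - p) / p * m < n + 1 := (Nat.floor_lt (by positivity)).1 (Nat.lt_succ_of_le hn)
      |>.trans_eq (by push_cast; rfl)
    rw [div_mul_eq_mul_div, div_lt_iff₀ hp0] at h1
    refine le_of_mul_le_mul_right ?_ (by positivity : (0 : ℝ) < n + 1)
    rw [choose_mul_pow_succ]
    exact mul_le_mul_of_nonneg_left (by linarith) (by positivity)

lemma factorial_eq_stirlingSeq_mul {n : ℕ} (hn : n ≠ 0) :
    (n.factorial : ℝ) = stirlingSeq n * (√(2 * n) * (n / Real.exp 1) ^ n) := by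
  have : (0 : ℝ) < n := by positivity
  rw [stirlingSeq, div_mul_cancel₀ _ (by positivity)]

/-- Binomial terms in terms of the Stirling sequence. -/
lemma sqrt_mul_choose_eq {p : ℝ} (hp1 : p < 1) {m n : ℕ} (hm : m ≠ 0) (hn : n ≠ 0) :
    √(2 * Real.pi * m) * √(1 - p) * (((n + m).choose m : ℝ) * p ^ m * (1 - p) ^ n) =
      √Real.pi * stirlingSeq (n + m) / (stirlingSeq n * stirlingSeq m) *
      √((1 - p) * (1 + ((n : ℝ) / m)⁻¹)) *
      ((p * (n + m) / m) ^ m * ((1 - p) * (n + m) / n) ^ n) := by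
  have hq : 0 < 1 - p := sub_pos.2 hp1
  have hm' : (0 : ℝ) < m := by positivity
  have hn' : (0 : ℝ) < n := by positivity
  have hsm : stirlingSeq m ≠ 0 := by unfold stirlingSeq; positivity
  have hsn : stirlingSeq n ≠ 0 := by unfold stirlingSeq; positivity
  have hch : ((n + m).choose m : ℝ) =
      (n + m).factorial / (m.factorial * n.factorial) := by
    rw [add_comm n m, Nat.cast_add_choose]
  rw [hch, factorial_eq_stirlingSeq_mul hm, factorial_eq_stirlingSeq_mul hn,
    factorial_eq_stirlingSeq_mul (by omega : n + m ≠ 0),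
    show (1 - p) * (1 + ((n : ℝ) / m)⁻¹) = (1 - p) * (n + m) / n by field_simp,
    Real.sqrt_div (by positivity), Real.sqrt_mul hq.le, Real.sqrt_mul (by positivity),
    Real.sqrt_mul (by positivity), Real.sqrt_mul (by positivity) (m : ℝ),
    Real.sqrt_mul (by positivity) (n : ℝ), Real.sqrt_mul (by positivity) ((n + m : ℕ) : ℝ)]
  push_cast
  simp only [div_pow, mul_pow, pow_add]
  field_simp

/-- `(1 - u/m)^m (1 + u/n)^n` is close to `1` for `u ∈ [0,1]` and large `m`, `n`. -/
lemma one_sub_div_pow_mul_one_add_div_pow_mem {u : ℝ} (hu0 : 0 ≤ u) (hu1 : u ≤ 1) {m n : ℕ}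
    (hm : 1 < m) (hn : n ≠ 0) :
    (1 - u / m) ^ m * (1 + u / n) ^ n ∈
      Set.Icc (Real.exp (-((m - 1 : ℝ)⁻¹ + (n : ℝ)⁻¹))) 1 := by
  have hm' : (1 : ℝ) < m := by exact_mod_cast hm
  have hn' : (0 : ℝ) < n := by positivity
  have hx : 0 < 1 - u / m := by
    rw [sub_pos, div_lt_one (by linarith)]; linarith
  have hy : 0 < 1 + u / n := by positivity
  have hxy : (1 - u / m) ^ m * (1 + u / n) ^ n =
      Real.exp (m * Real.log (1 - u / m) + n * Real.log (1 + u / n)) := by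
    rw [Real.exp_add, Real.exp_nat_mul, Real.exp_nat_mul, Real.exp_log hx, Real.exp_log hy]
  rw [hxy, Set.mem_Icc, Real.exp_le_exp, Real.exp_le_one_iff]
  have hmu : 0 < m - u := by linarith
  have hnu : 0 < n + u := by linarith
  have husq : u ^ 2 ≤ 1 := pow_le_one₀ hu0 hu1
  constructor
  · have h1 := mul_le_mul_of_nonneg_left (Real.one_sub_inv_le_log_of_pos hx) (by positivity :
      (0 : ℝ) ≤ m)
    have h2 := mul_le_mul_of_nonneg_left (Real.one_sub_inv_le_log_of_pos hy) hn'.le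
    have e1 : (m : ℝ) * (1 - (1 - u / m)⁻¹) = -u - u ^ 2 / (m - u) := by
      have : 1 - u / m = (m - u) / m := by field_simp
      rw [this]; field_simp; ring
    have e2 : (n : ℝ) * (1 - (1 + u / n)⁻¹) = u - u ^ 2 / (n + u) := by
      have : 1 + u / n = (n + u) / n := by field_simp
      rw [this]; field_simp; ring
    have b1 : u ^ 2 / (m - u) ≤ (m - 1 : ℝ)⁻¹ := by
      rw [← one_div]; exact div_le_div₀ zero_le_one husq (by linarith) (by linarith)
    have b2 : u ^ 2 / (n + u) ≤ (n : ℝ)⁻¹ := by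
      rw [← one_div]; exact div_le_div₀ zero_le_one husq hn' (by linarith)
    linarith
  · have h1 := mul_le_mul_of_nonneg_left (Real.log_le_sub_one_of_pos hx) (by positivity :
      (0 : ℝ) ≤ m)
    have h2 := mul_le_mul_of_nonneg_left (Real.log_le_sub_one_of_pos hy) hn'.le
    have e1 : (m : ℝ) * (1 - u / m - 1) = -u := by field_simp; ring
    have e2 : (n : ℝ) * (1 + u / n - 1) = u := by field_simp; ring
    linarith

lemma pow_mul_pow_floor_mem {p : ℝ} (hp0 : 0 < p) (hp1 : p < 1) {m n : ℕ}
    (hmn : n = ⌊(1 - p) / p * (m : ℝ)⌋₊) (hm : 1 < m) (hn : n ≠ 0) :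
    (p * (n + m) / m) ^ m * ((1 - p) * (n + m) / n) ^ n ∈
      Set.Icc (Real.exp (-((m - 1 : ℝ)⁻¹ + (n : ℝ)⁻¹))) 1 := by
  have hq : 0 < 1 - p := sub_pos.2 hp1
  have hm' : (0 : ℝ) < m := by positivity
  have hn' : (0 : ℝ) < n := by positivity
  have h0 : (n : ℝ) ≤ (1 - p) / p * m := hmn ▸ Nat.floor_le (by positivity)
  have h1 : (1 - p) / p * m < n + 1 := hmn ▸ Nat.lt_floor_add_one _
  rw [div_mul_eq_mul_div, le_div_iff₀ hp0] at h0
  rw [div_mul_eq_mul_div, div_lt_iff₀ hp0] at h1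
  convert one_sub_div_pow_mul_one_add_div_pow_mem (u := (1 - p) * m - n * p) (by linarith)
    (by linarith) hm hn using 3
  · field_simp; ring
  · field_simp; ring

/-- the asymptotics of Proposition A.4 of the paper. For `p ∈ (0,1)`,
with `F(m) = ⨆_n C(n+m,m)·p^m·(1−p)^n`, one has `√(2πm)·√(1−p)·F(m) → 1` as `m → ∞`. -/
theorem binomial_max_asymptotics
    (p : ℝ) (hp0 : 0 < p) (hp1 : p < 1) :
    Tendsto
      (fun m : ℕ => Real.sqrt (2 * Real.pi * m) * Real.sqrt (1 - p) *
        ⨆ n : ℕ, ((n + m).choose m : ℝ) * p ^ m * (1 - p) ^ n)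
      atTop (nhds 1) := by
  have hq : 0 < 1 - p := sub_pos.2 hp1
  have hr : 0 < (1 - p) / p := div_pos hq hp0
  simp_rw [iSup_choose_mul_pow hp0 hp1]
  obtain ⟨N, hN⟩ : ∃ N : ℕ → ℕ, ∀ m : ℕ, N m = ⌊(1 - p) / p * (m : ℝ)⌋₊ := ⟨_, fun _ => rfl⟩
  simp_rw [← hN]
  have hNtop : Tendsto N atTop atTop := by
    simp_rw [funext hN]
    exact tendsto_nat_floor_atTop.comp
      (tendsto_natCast_atTop_atTop.const_mul_atTop hr)
  have hNdiv : Tendsto (fun m : ℕ => (N m : ℝ) / m) atTop (𝓝 ((1 - p) / p)) := by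
    simp_rw [funext hN]
    exact (tendsto_nat_floor_mul_div_atTop hr.le).comp tendsto_natCast_atTop_atTop
  have hNm : Tendsto (fun m => N m + m) atTop atTop :=
    tendsto_atTop_mono (fun m => Nat.le_add_left m (N m)) tendsto_id
  have hpi : √Real.pi ≠ 0 := by positivity
  have hS : Tendsto (fun m => √Real.pi * stirlingSeq (N m + m) /
      (stirlingSeq (N m) * stirlingSeq m)) atTop (𝓝 1) := by
    have h := ((tendsto_stirlingSeq_sqrt_pi.comp hNm).const_mul √Real.pi).div
      ((tendsto_stirlingSeq_sqrt_pi.comp hNtop).mul tendsto_stirlingSeq_sqrt_pi)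
      (mul_ne_zero hpi hpi)
    rwa [div_self (mul_ne_zero hpi hpi)] at h
  have hR : Tendsto (fun m : ℕ => √((1 - p) * (1 + ((N m : ℝ) / m)⁻¹))) atTop (𝓝 1) := by
    have h := (((hNdiv.inv₀ hr.ne').const_add 1).const_mul (1 - p)).sqrt
    rwa [show (1 - p) * (1 + ((1 - p) / p)⁻¹) = 1 by field_simp; ring, Real.sqrt_one] at h
  have hlarge : ∀ᶠ m in atTop, 1 < m ∧ N m ≠ 0 :=
    (eventually_gt_atTop 1).and (hNtop.eventually_ne_atTop 0)
  have hP : Tendsto (fun m : ℕ => (p * (N m + m) / m) ^ m * ((1 - p) * (N m + m) / N m) ^ N m)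
      atTop (𝓝 1) := by
    have hlow : Tendsto (fun m : ℕ => Real.exp (-((m - 1 : ℝ)⁻¹ + (N m : ℝ)⁻¹))) atTop (𝓝 1) := by
      have h1 : Tendsto (fun m : ℕ => (m - 1 : ℝ)⁻¹) atTop (𝓝 0) :=
        tendsto_inv_atTop_zero.comp
          (tendsto_atTop_add_const_right _ (-1) tendsto_natCast_atTop_atTop)
      have h2 : Tendsto (fun m : ℕ => (N m : ℝ)⁻¹) atTop (𝓝 0) :=
        tendsto_inv_atTop_zero.comp (tendsto_natCast_atTop_atTop.comp hNtop)
      simpa using (h1.add h2).neg.rexp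
    refine tendsto_of_tendsto_of_tendsto_of_le_of_le' hlow tendsto_const_nhds ?_ ?_
    · filter_upwards [hlarge] with m hm
      exact (pow_mul_pow_floor_mem hp0 hp1 (hN m) hm.1 hm.2).1
    · filter_upwards [hlarge] with m hm
      exact (pow_mul_pow_floor_mem hp0 hp1 (hN m) hm.1 hm.2).2
  have h := (hS.mul hR).mul hP
  rw [mul_one, mul_one] at h
  refine h.congr' ?_
  filter_upwards [hlarge] with m hm
  exact (sqrt_mul_choose_eq hp1 (by omega) hm.2).symm
end
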